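/- arXiv:1609.06605 — 4 statements merged into one kernel-verified Lean document; each statement's English description precedes it below -/
import Mathlib

section
/- Let G be a group and α : G → G a surjective endomorphism that is locally of finite order, i.e., for every g ∈ G there exists n ≥ 1 with αⁿ(g) = e. If A ⊆ G is a subgroup of finite index with α(A) ⊆ A, then A = G. In particular, if G admits a finite-index abelian subgroup A with α(A) ⊆ A, then G is abelian. -/
/-- A finite-index subgroup that is mapped into itself by a surjective endomorphism equals its
preimage. -/
theorem Subgroup.comap_eq_of_surjective_of_index_ne_zero {G : Type*} [Group G] {f : G →* G}
    (hf : Function.Surjective f) {A : Subgroup G} (hA : A.index ≠ 0) (h : A ≤ A.comap f) :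
    A.comap f = A := by
  have hmul := Subgroup.relIndex_mul_index h
  rw [Subgroup.index_comap_of_surjective A hf] at hmul
  exact (Subgroup.relIndex_eq_one.mp ((Nat.mul_eq_right hA).mp hmul)).antisymm h

/-- Let `G` be a group and `α : G → G` a surjective endomorphism that is
locally of finite order, i.e. for every `g ∈ G` there is `n ≥ 1` with `αⁿ(g) = e`. If
`A ⊆ G` is a finite-index subgroup with `α(A) ⊆ A`, then `A = G`. In particular, if `A` is
moreover abelian, then `G` is abelian. -/
theorem stmt_7 {G : Type*} [Group G] (α : Monoid.End G)
    (hsurj : Function.Surjective α)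
    (hord : ∀ g : G, ∃ n : ℕ, 1 ≤ n ∧ (α ^ n) g = 1)
    (A : Subgroup G) (hfin : A.index ≠ 0) (hinv : ∀ a ∈ A, α a ∈ A) :
    A = ⊤ ∧ ((∀ x ∈ A, ∀ y ∈ A, x * y = y * x) → ∀ x y : G, x * y = y * x) := by
  have hcomap := Subgroup.comap_eq_of_surjective_of_index_ne_zero hsurj hfin hinv
  have hiter : ∀ (n : ℕ) (g : G), (α ^ n) g ∈ A → g ∈ A := by
    intro n
    induction n with
    | zero => exact fun g hg => by simpa using hg
    | succ n ih =>
      intro g hg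
      rw [pow_succ, Monoid.End.coe_mul, Function.comp_apply] at hg
      exact hcomap.le (ih (α g) hg)
  have hmem : ∀ g : G, g ∈ A := fun g => by
    obtain ⟨n, -, hn⟩ := hord g
    exact hiter n g (hn ▸ A.one_mem)
  exact ⟨(Subgroup.eq_top_iff' A).mpr hmem, fun h x y => h x (hmem x) y (hmem y)⟩
end

section
/- Let Γ be a group and φ : Γ → Γ an injective endomorphism such that φⁿ(Γ) is normal in Γ for every n ≥ 1 (so that the stable image φ^∞(Γ) := ⋂_{n≥1} φⁿ(Γ) is a normal subgroup). Let Λ := Γ/φ^∞(Γ) and let φ̄ : Λ → Λ be the endomorphism induced by φ. Then φ̄ is injective, the index of φ̄(Λ) in Λ equals the index of φ(Γ) in Γ, and the stable image of φ̄ is trivial: ⋂_{n≥1} φ̄ⁿ(Λ) = 1. -/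
/-- If `ψ` on a quotient is induced by `φ`, then its powers are induced by the powers of `φ`. -/
theorem pow_apply_mk_of_induced {G : Type*} [Group G] {N : Subgroup G} [N.Normal]
    {φ : Monoid.End G} {ψ : Monoid.End (G ⧸ N)}
    (h : ∀ g : G, ψ (QuotientGroup.mk' N g) = QuotientGroup.mk' N (φ g)) (n : ℕ) (g : G) :
    (ψ ^ n) (QuotientGroup.mk' N g) = QuotientGroup.mk' N ((φ ^ n) g) := by
  rw [Monoid.End.coe_pow, Monoid.End.coe_pow]
  exact (Function.Semiconj.iterate_right (f := QuotientGroup.mk' N)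
    (fun g => (h g).symm) n g).symm

/-- Let `Γ` be a group and `φ : Γ → Γ` an injective endomorphism such that
`φⁿ(Γ)` is normal in `Γ` for every `n ≥ 1` (so the stable image `φ^∞(Γ) = ⋂_{n≥1} φⁿ(Γ)` is
normal). Let `Λ = Γ/φ^∞(Γ)` and `φ̄ : Λ → Λ` the endomorphism induced by `φ`. Then `φ̄` is
injective, the index of `φ̄(Λ)` in `Λ` equals the index of `φ(Γ)` in `Γ`, and the stable image
of `φ̄` is trivial. -/
theorem stmt_9 {Γ : Type*} [Group Γ] (φ : Monoid.End Γ) (hφ : Function.Injective φ)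
    (hnorm : ∀ n : ℕ, 1 ≤ n → (MonoidHom.range (φ ^ n : Γ →* Γ)).Normal) :
    let S : Subgroup Γ := ⨅ n : ℕ, MonoidHom.range (φ ^ (n + 1) : Γ →* Γ)
    letI : S.Normal :=
      { conj_mem := fun x hx g =>
          Subgroup.mem_iInf.mpr fun n =>
            (hnorm (n + 1) (Nat.succ_le_succ (Nat.zero_le n))).conj_mem x
              (Subgroup.mem_iInf.mp hx n) g }
    ∀ φbar : Monoid.End (Γ ⧸ S),
      (∀ g : Γ, φbar (QuotientGroup.mk' S g) = QuotientGroup.mk' S (φ g)) →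
      Function.Injective φbar ∧
        (MonoidHom.range (φbar : Γ ⧸ S →* Γ ⧸ S)).index =
          (MonoidHom.range (φ : Γ →* Γ)).index ∧
        (⨅ n : ℕ, MonoidHom.range (φbar ^ (n + 1) : Γ ⧸ S →* Γ ⧸ S)) = ⊥ := by
  intro S φbar hbar
  have hS : S.Normal := Subgroup.normal_iInf_normal fun n => hnorm (n + 1) n.succ_pos
  have mem_S : ∀ x, x ∈ S ↔ ∀ n : ℕ, ∃ y, (φ ^ (n + 1)) y = x := fun x => Subgroup.mem_iInf
  refine ⟨?_, ?_, ?_⟩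
  · refine (injective_iff_map_eq_one φbar).mpr fun a ha => ?_
    obtain ⟨g, rfl⟩ := QuotientGroup.mk'_surjective S a
    rw [hbar] at ha
    have hg : φ g ∈ S := (QuotientGroup.eq_one_iff _).mp ha
    refine (QuotientGroup.eq_one_iff g).mpr ((mem_S g).mpr fun n => ?_)
    obtain ⟨y, hy⟩ := (mem_S _).mp hg (n + 1)
    rw [pow_succ'] at hy
    exact ⟨y, hφ hy⟩
  · have hrange : MonoidHom.range (φbar : Γ ⧸ S →* Γ ⧸ S) =
        (MonoidHom.range (φ : Γ →* Γ)).map (QuotientGroup.mk' S) := by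
      ext a
      constructor
      · rintro ⟨b, rfl⟩
        obtain ⟨g, rfl⟩ := QuotientGroup.mk'_surjective S b
        exact ⟨φ g, ⟨g, rfl⟩, (hbar g).symm⟩
      · rintro ⟨_, ⟨g, rfl⟩, rfl⟩
        exact ⟨QuotientGroup.mk' S g, hbar g⟩
    rw [hrange]
    refine Subgroup.index_map_eq _ (QuotientGroup.mk'_surjective S) ?_
    rw [QuotientGroup.ker_mk']
    intro x hx
    obtain ⟨y, hy⟩ := (mem_S x).mp hx 0
    rw [zero_add, pow_one] at hy
    exact ⟨y, hy⟩
  · refine (Subgroup.eq_bot_iff_forall _).mpr fun a ha => ?_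
    obtain ⟨g, rfl⟩ := QuotientGroup.mk'_surjective S a
    refine (QuotientGroup.eq_one_iff g).mpr ((mem_S g).mpr fun n => ?_)
    obtain ⟨b, hb⟩ := Subgroup.mem_iInf.mp ha n
    obtain ⟨k, rfl⟩ := QuotientGroup.mk'_surjective S b
    have hk : QuotientGroup.mk' S ((φ ^ (n + 1)) k) = QuotientGroup.mk' S g :=
      (pow_apply_mk_of_induced hbar (n + 1) k).symm.trans hb
    obtain ⟨y, hy⟩ := (mem_S _).mp (QuotientGroup.eq.mp hk) n
    exact ⟨k * y, by rw [map_mul, hy, mul_inv_cancel_left]⟩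
end

section
/- Let n ≥ 1 and let A be an n×n integer matrix with det A ≠ 0, regarded as an injective linear map A : ℝⁿ → ℝⁿ preserving ℤⁿ. Suppose that ⋂_{k≥1} Aᵏ(ℤⁿ) = {0}. Then the subgroup ⋃_{k≥0} A^{-k}(ℤⁿ) = { v ∈ ℝⁿ : Aᵏ v ∈ ℤⁿ for some k ≥ 0 } is dense in ℝⁿ. -/
open Polynomial MeasureTheory
open scoped Matrix

theorem Module.AEval.exists_coeff_zero_eq_one_smul_eq_zero {M : Type*} [AddCommGroup M]
    [Module.Finite ℤ M] (f : M →ₗ[ℤ] M) (hf : Function.Injective f) (m : M)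
    (hm : ∀ k : ℕ, ∃ w, (f ^ k) w = m) :
    ∃ p : ℤ[X], p.coeff 0 = 1 ∧ aeval f p m = 0 := by
  let N := Module.AEval' f
  let e := Module.AEval'.of f
  let L : Submodule ℤ[X] N := ⨅ k : ℕ, LinearMap.range (LinearMap.lsmul ℤ[X] N (X ^ k))
  have hX : Function.Injective fun x : N => (X : ℤ[X]) • x := by
    have hXe (x : M) : (X : ℤ[X]) • e x = e (f x) := Module.AEval'.X_smul_of f x
    intro x y hxy
    obtain ⟨x, rfl⟩ := e.surjective x
    obtain ⟨y, rfl⟩ := e.surjective y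
    dsimp only at hxy
    rw [hXe, hXe] at hxy
    rw [hf (e.injective hxy)]
  have hL : ∀ x, x ∈ L ↔ ∀ k : ℕ, ∃ y : N, (X ^ k : ℤ[X]) • y = x := fun x => by
    simp [L, Submodule.mem_iInf]
  have : Module.Finite ℤ[X] N := inferInstance
  have hle : L ≤ Ideal.span {(X : ℤ[X])} • L := by
    intro x hx
    rw [hL] at hx
    obtain ⟨y, rfl⟩ := hx 1
    rw [pow_one]
    refine Submodule.smul_mem_smul (Ideal.mem_span_singleton_self _) ((hL y).2 fun k => ?_)
    obtain ⟨z, hz⟩ := hx (k + 1)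
    refine ⟨z, hX ?_⟩
    simpa [pow_succ', mul_smul] using hz
  obtain ⟨p, hp, hpL⟩ := Submodule.exists_sub_one_mem_and_smul_eq_zero_of_fg_of_le_smul
    _ L (IsNoetherian.noetherian L) hle
  refine ⟨p, ?_, ?_⟩
  · rw [Ideal.mem_span_singleton, X_dvd_iff] at hp
    simpa [sub_eq_zero] using hp
  · refine e.injective ?_
    have := hpL (e m) ((hL _).2 fun k => ?_)
    · rw [map_zero]
      exact this
    · obtain ⟨w, hw⟩ := hm k
      refine ⟨e w, ?_⟩
      rw [← hw]
      exact Module.AEval'.X_pow_smul_of f w k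

theorem Matrix.exists_ne_zero_forall_mulVec_pow_eq {n : Type*} [Fintype n] [DecidableEq n]
    (A : Matrix n n ℤ) (hA : A.det ≠ 0) (m : n → ℤ) (hm0 : m ≠ 0)
    (hm : ∀ k : ℕ, ∃ w, w ᵥ* A ^ k = m) :
    ∃ v ≠ 0, ∀ k : ℕ, ∃ w, A ^ k *ᵥ w = v := by
  have hT (B : Matrix n n ℤ) (p : ℤ[X]) : aeval B.mulVecLin p = (aeval B p).mulVecLin := by
    exact aeval_algHom_apply (Matrix.toLinAlgEquiv' (R := ℤ) (n := n)).toAlgHom B p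
  have hpow (B : Matrix n n ℤ) (k : ℕ) : B.mulVecLin ^ k = (B ^ k).mulVecLin := by
    simpa using hT B (X ^ k)
  obtain ⟨p, hp, hpm⟩ := Module.AEval.exists_coeff_zero_eq_one_smul_eq_zero Aᵀ.mulVecLin
    (by
      rw [injective_iff_map_eq_zero]
      intro a ha
      exact Matrix.eq_zero_of_mulVec_eq_zero (by simpa using hA) ha) m
    (fun k => by
      obtain ⟨w, hw⟩ := hm k
      exact ⟨w, by rw [hpow, Matrix.mulVecLin_apply, ← Matrix.transpose_pow,
        Matrix.mulVec_transpose, hw]⟩)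
  rw [hT, Matrix.mulVecLin_apply] at hpm
  have hdet : (aeval A p).det = 0 := by
    have h : (aeval Aᵀ p) = (aeval A p)ᵀ := by
      simp_rw [aeval_eq_sum_range, Matrix.transpose_sum, Matrix.transpose_smul,
        Matrix.transpose_pow]
    rw [← Matrix.det_transpose, ← h]
    exact Matrix.exists_mulVec_eq_zero_iff.1 ⟨m, hm0, hpm⟩
  obtain ⟨v, hv0, hv⟩ := Matrix.exists_mulVec_eq_zero_iff.2 hdet
  refine ⟨v, hv0, fun k => ?_⟩
  have h : Commute A (aeval A p.divX) := by
    simpa using (Commute.all X p.divX).map (aeval A)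
  have hc : Commute A (-aeval A p.divX) := h.neg_right
  have hfix : (A * -aeval A p.divX) *ᵥ v = v := by
    rw [← divX_mul_X_add p, hp] at hv
    simp only [map_add, map_mul, aeval_X, map_one, Matrix.add_mulVec, Matrix.one_mulVec] at hv
    rw [mul_neg, h.eq, Matrix.neg_mulVec]
    exact neg_eq_of_add_eq_zero_right hv
  refine ⟨(-aeval A p.divX) ^ k *ᵥ v, ?_⟩
  rw [Matrix.mulVec_mulVec, ← hc.mul_pow]
  induction k with
  | zero => simp
  | succ k ih => rw [pow_succ, ← Matrix.mulVec_mulVec, hfix, ih]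

theorem UnitAddTorus.dense_of_forall_exists_mFourier_ne_one {d : Type*} [Fintype d]
    (K : AddSubgroup (UnitAddTorus d)) (hK : ∀ m ≠ 0, ∃ x ∈ K, mFourier m x ≠ 1) :
    Dense (K : Set (UnitAddTorus d)) := by
  let H := K.topologicalClosure
  have hH : IsClosed (H : Set (UnitAddTorus d)) := K.isClosed_topologicalClosure
  have : CompactSpace H := isCompact_iff_compactSpace.1 hH.isCompact
  let _ : MeasurableSpace H := borel H
  have : BorelSpace H := ⟨rfl⟩
  let μ : Measure H := Measure.addHaarMeasure ⊤
  have : IsProbabilityMeasure μ := ⟨Measure.addHaarMeasure_self⟩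
  have hint (f : C(UnitAddTorus d, ℂ)) (x₀ : UnitAddTorus d) :
      Integrable (fun h : H => f (h + x₀)) μ :=
    Continuous.integrable_of_hasCompactSupport (by fun_prop) (HasCompactSupport.of_compactSpace _)
  rw [dense_iff_closure_eq, Set.eq_univ_iff_forall]
  intro x₀
  by_contra hx₀
  replace hx₀ : x₀ ∉ H := hx₀
  have hadd (m : d → ℤ) (x y : UnitAddTorus d) :
      mFourier m (x + y) = mFourier m x * mFourier m y := by
    simp [mFourier, Finset.prod_mul_distrib, fourier_apply, AddCircle.toCircle_add]
  have hchar (m : d → ℤ) (x : UnitAddTorus d) :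
      ∫ h : H, mFourier m (h + x) ∂μ = ∫ h : H, mFourier m (h + 0) ∂μ := by
    rcases eq_or_ne m 0 with rfl | hm
    · simp [mFourier_zero]
    obtain ⟨k, hkK, hk⟩ := hK m hm
    have h0 : ∫ h : H, mFourier m h ∂μ = 0 := by
      have h1 := integral_add_right_eq_self (μ := μ) (fun h : H => mFourier m h)
        ⟨k, K.le_topologicalClosure hkK⟩
      simp only [AddSubgroup.coe_add, hadd, integral_mul_const] at h1
      by_contra hne
      exact hk (mul_left_cancel₀ hne (h1.trans (mul_one _).symm))
    simp [hadd, integral_mul_const, h0]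
  have hall (f : C(UnitAddTorus d, ℂ)) :
      ∫ h : H, f (h + x₀) ∂μ = ∫ h : H, f (h + 0) ∂μ := by
    have hcont (x : UnitAddTorus d) :
        Continuous fun f : C(UnitAddTorus d, ℂ) => ∫ h : H, f (h + x) ∂μ := by
      refine (LipschitzWith.of_dist_le_mul (K := 1) fun f g => ?_).continuous
      rw [dist_eq_norm, ← integral_sub (hint f x) (hint g x), NNReal.coe_one, one_mul]
      refine (norm_integral_le_of_norm_le_const (C := dist f g)
        (Filter.Eventually.of_forall fun h => ?_)).trans (by simp)
      rw [← dist_eq_norm]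
      exact ContinuousMap.dist_apply_le_dist _
    have hf : f ∈ closure (Submodule.span ℂ (Set.range (mFourier (d := d))) :
        Set C(UnitAddTorus d, ℂ)) := by
      rw [← Submodule.topologicalClosure_coe, span_mFourier_closure_eq_top]
      trivial
    refine closure_minimal (fun g hg => ?_) (isClosed_eq (hcont x₀) (hcont 0)) hf
    induction hg using Submodule.span_induction with
    | mem g hg =>
      obtain ⟨m, rfl⟩ := hg
      exact hchar m x₀
    | zero => simp
    | add g₁ g₂ _ _ h₁ h₂ =>
      simp only [Set.mem_ofPred_eq, ContinuousMap.add_apply] at h₁ h₂ ⊢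
      rw [integral_add (hint _ _) (hint _ _), integral_add (hint _ _) (hint _ _), h₁, h₂]
    | smul c g _ h =>
      simp only [Set.mem_ofPred_eq, ContinuousMap.smul_apply, integral_smul] at h ⊢
      rw [h]
  obtain ⟨f, hf0, hf1, -⟩ := exists_continuous_zero_one_of_isClosed hH
    (hH.preimage (continuous_sub_right x₀)) (by
      rw [Set.disjoint_left]
      intro y hy hy'
      exact hx₀ (by simpa using H.sub_mem hy hy'))
  have h1 := hall ((⟨Complex.ofReal, Complex.continuous_ofReal⟩ : C(ℝ, ℂ)).comp f)
  have e0 (h : H) : f h = 0 := hf0 h.2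
  have e1 (h : H) : f (h + x₀) = 1 := hf1 (by simp)
  simp [e0, e1] at h1

theorem dense_of_forall_exists_sum_ne_intCast {d : Type*} [Fintype d] (G : AddSubgroup (d → ℝ))
    (hZ : ∀ v : d → ℤ, (fun i => (v i : ℝ)) ∈ G)
    (hG : ∀ m : d → ℤ, m ≠ 0 → ∃ x ∈ G, ∀ z : ℤ, ∑ i, m i * x i ≠ z) :
    Dense (G : Set (d → ℝ)) := by
  let π : (d → ℝ) →+ UnitAddTorus d :=
    (QuotientAddGroup.mk' (AddSubgroup.zmultiples (1 : ℝ))).compLeft d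
  have hπ : IsOpenMap π :=
    IsOpenMap.piMap (fun _ => QuotientAddGroup.isOpenMap_coe)
      (Filter.Eventually.of_forall fun _ => QuotientAddGroup.mk'_surjective _)
  have hd : Dense (G.map π : Set (UnitAddTorus d)) := by
    refine UnitAddTorus.dense_of_forall_exists_mFourier_ne_one _ fun m hm => ?_
    obtain ⟨x, hx, hxm⟩ := hG m hm
    refine ⟨π x, ⟨x, hx, rfl⟩, fun h => ?_⟩
    have h' : Complex.exp (∑ i, 2 * Real.pi * Complex.I * m i * x i) = 1 := by
      rw [Complex.exp_sum, ← h]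
      refine Finset.prod_congr rfl fun i _ => ?_
      have := fourier_coe_apply (T := 1) (n := m i) (x := x i)
      simp only [Complex.ofReal_one, div_one] at this
      exact this.symm
    obtain ⟨z, hz⟩ := Complex.exp_eq_one_iff.1 h'
    refine hxm z ?_
    have h2 : (2 * Real.pi * Complex.I : ℂ) * ∑ i, (m i : ℂ) * x i =
        2 * Real.pi * Complex.I * z := by
      rw [mul_comm _ (z : ℂ), ← hz, Finset.mul_sum]
      simp [mul_assoc]
    exact_mod_cast mul_left_cancel₀ Complex.two_pi_I_ne_zero h2
  refine (hd.preimage hπ).mono ?_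
  rintro y ⟨x, hx, hxy⟩
  have hz (i : d) : ∃ z : ℤ, (z : ℝ) = y i - x i := by
    have := congrFun hxy i
    obtain ⟨z, hz⟩ := AddSubgroup.mem_zmultiples_iff.1 (QuotientAddGroup.eq.1 this)
    exact ⟨z, by simpa [neg_add_eq_sub] using hz⟩
  choose z hz using hz
  have hy : y = x + fun i => (z i : ℝ) := by
    ext i
    simp [hz]
  exact hy ▸ G.add_mem hx (hZ z)


/-- Let `A` be an `n × n` integer matrix with `det A ≠ 0`, regarded as an
injective linear map of `ℝⁿ` preserving `ℤⁿ`. If `⋂_{k ≥ 1} Aᵏ(ℤⁿ) = {0}`, then the subgroup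
`⋃_{k ≥ 0} A⁻ᵏ(ℤⁿ) = {v ∈ ℝⁿ : Aᵏ v ∈ ℤⁿ for some k ≥ 0}` is dense in `ℝⁿ`. -/
theorem stmt_12 (n : ℕ) (hn : 1 ≤ n) (A : Matrix (Fin n) (Fin n) ℤ) (hdet : A.det ≠ 0)
    (hstab : (⋂ k : ℕ, Set.range fun v : Fin n → ℤ => (A ^ (k + 1)).mulVec v) = {0}) :
    Dense {x : Fin n → ℝ | ∃ (k : ℕ) (v : Fin n → ℤ),
      ((A.map (Int.cast : ℤ → ℝ)) ^ k).mulVec x = fun i => (v i : ℝ)} := by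
  set B : Matrix (Fin n) (Fin n) ℝ := A.map (Int.cast : ℤ → ℝ) with hB
  have hpow (k : ℕ) : B ^ k = (A ^ k).map (Int.cast : ℤ → ℝ) :=
    (Matrix.map_pow A (Int.castRingHom ℝ) k).symm
  have hcast (C : Matrix (Fin n) (Fin n) ℤ) (v : Fin n → ℤ) :
      C.map (Int.cast : ℤ → ℝ) *ᵥ (fun i => (v i : ℝ)) = fun i => ((C *ᵥ v) i : ℝ) := by
    ext i
    simp [Matrix.mulVec, dotProduct]
  have hBdet (k : ℕ) : IsUnit (B ^ k).det := by
    have h : B.det = (A.det : ℝ) := (Int.cast_det A).symm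
    rw [Matrix.det_pow, h]
    exact (pow_ne_zero k (Int.cast_ne_zero.2 hdet)).isUnit
  have hlift {k l : ℕ} (hkl : k ≤ l) {x : Fin n → ℝ} {v : Fin n → ℤ}
      (hx : B ^ k *ᵥ x = fun i => (v i : ℝ)) :
      B ^ l *ᵥ x = fun i => ((A ^ (l - k) *ᵥ v) i : ℝ) := by
    rw [← hcast, ← hpow, ← hx, Matrix.mulVec_mulVec, ← pow_add, Nat.sub_add_cancel hkl]
  let G : AddSubgroup (Fin n → ℝ) :=
    { carrier := {x | ∃ (k : ℕ) (v : Fin n → ℤ), B ^ k *ᵥ x = fun i => (v i : ℝ)}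
      zero_mem' := ⟨0, 0, by ext; simp⟩
      add_mem' := by
        rintro x y ⟨k, v, hx⟩ ⟨l, w, hy⟩
        refine ⟨max k l, A ^ (max k l - k) *ᵥ v + A ^ (max k l - l) *ᵥ w, ?_⟩
        rw [Matrix.mulVec_add, hlift (le_max_left k l) hx, hlift (le_max_right k l) hy]
        ext i
        simp
      neg_mem' := by
        rintro x ⟨k, v, hx⟩
        refine ⟨k, -v, ?_⟩
        rw [Matrix.mulVec_neg, hx]
        ext i
        simp }
  refine dense_of_forall_exists_sum_ne_intCast G (fun v => ⟨0, v, by simp⟩) fun m hm => ?_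
  by_contra! hG
  obtain ⟨v, hv0, hv⟩ := A.exists_ne_zero_forall_mulVec_pow_eq hdet m hm fun k => by
    have hint (j : Fin n) : ∃ z : ℤ, ((fun i => (m i : ℝ)) ᵥ* (B ^ k)⁻¹) j = z := by
      obtain ⟨z, hz⟩ := hG ((B ^ k)⁻¹.col j) ⟨k, Pi.single j 1, by
        rw [← Matrix.mulVec_single_one, Matrix.mulVec_mulVec,
          Matrix.mul_nonsing_inv _ (hBdet k), Matrix.one_mulVec]
        ext i
        simp [Pi.single_apply]⟩
      exact ⟨z, hz⟩
    choose w hw using hint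
    refine ⟨w, ?_⟩
    have h : (fun i => (w i : ℝ)) ᵥ* B ^ k = fun i => (m i : ℝ) := by
      rw [← funext hw, Matrix.vecMul_vecMul, Matrix.nonsing_inv_mul _ (hBdet k),
        Matrix.vecMul_one]
    ext i
    have hi := congrFun h i
    simp only [hpow, Matrix.vecMul, dotProduct, Matrix.map_apply] at hi ⊢
    exact_mod_cast hi
  refine hv0 (hstab.le (Set.mem_iInter.2 fun k => hv (k + 1)))
end

section
/- Let n ≥ 1 and let A be an n×n integer matrix with det A ≠ 0 such that ⋂_{k≥1} Aᵏ(ℤⁿ) = {0}. Then no complex eigenvalue λ of A is an algebraic unit; that is, there is no root λ of the characteristic polynomial of A such that both λ and λ⁻¹ are algebraic integers. -/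
open Polynomial in
/-- If a complex root of the characteristic polynomial of an integer matrix `A` is a root of an
integer polynomial `p`, then `p(A)` is singular. -/
theorem Matrix.det_aeval_eq_zero_of_isRoot_charpoly {n : Type*} [Fintype n] [DecidableEq n]
    (A : Matrix n n ℤ) {z : ℂ} (hz : (Matrix.charpoly (A.map (Int.cast : ℤ → ℂ))).IsRoot z)
    {p : ℤ[X]} (hp : aeval z p = 0) : (aeval A p).det = 0 := by
  have hspec : z ∈ spectrum ℂ (A.map (Int.cast : ℤ → ℂ)) :=
    Matrix.mem_spectrum_iff_isRoot_charpoly.mpr hz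
  have hzero : (0 : ℂ) ∈ spectrum ℂ
      (aeval (A.map (Int.cast : ℤ → ℂ)) (p.map (algebraMap ℤ ℂ))) :=
    spectrum.subset_polynomial_aeval _ _ ⟨z, hspec, by
      exact (eval_map_algebraMap p z).trans hp⟩
  have hmap : aeval (A.map (Int.cast : ℤ → ℂ)) (p.map (algebraMap ℤ ℂ)) =
      (Int.castRingHom ℂ).mapMatrix (aeval A p) := by
    rw [aeval_map_algebraMap]
    exact aeval_algHom_apply (Int.castRingHom ℂ).mapMatrix.toIntAlgHom A p
  rw [hmap, spectrum.zero_mem_iff, Matrix.isUnit_iff_isUnit_det, isUnit_iff_ne_zero, not_not,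
    ← RingHom.map_det] at hzero
  simpa using hzero

open Polynomial in
/-- A vector killed by `p(A)`, where `p` has constant term `1`, lies in the range of every power
of `A`. -/
theorem Matrix.exists_pow_mulVec_eq_of_aeval_mulVec_eq_zero {n R : Type*} [Fintype n]
    [DecidableEq n] [CommRing R] (A : Matrix n n R) {p : R[X]} (hp : p.coeff 0 = 1) {v : n → R}
    (hv : (aeval A p).mulVec v = 0) (k : ℕ) : ∃ w, (A ^ k).mulVec w = v := by
  have hstep : (A * -aeval A p.divX).mulVec v = v := by
    have h := congrArg (aeval A) (X_mul_divX_add p)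
    rw [hp] at h
    simp only [map_add, map_mul, aeval_X, map_one] at h
    rw [← h, Matrix.add_mulVec, Matrix.one_mulVec] at hv
    rw [mul_neg, Matrix.neg_mulVec]
    exact (eq_neg_of_add_eq_zero_right hv).symm
  have hcomm : Commute A (-aeval A p.divX) := by
    have h := Commute.map (Commute.all X p.divX) (aeval A)
    rw [aeval_X] at h
    exact h.neg_right
  refine ⟨((-aeval A p.divX) ^ k).mulVec v, ?_⟩
  rw [Matrix.mulVec_mulVec, ← hcomm.mul_pow]
  induction k with
  | zero => simp
  | succ k ih => rw [pow_succ, ← Matrix.mulVec_mulVec, hstep, ih]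

/-- Let `A` be an `n × n` integer matrix with `det A ≠ 0` such that
`⋂_{k ≥ 1} Aᵏ(ℤⁿ) = {0}`. Then no complex eigenvalue `λ` of `A` (i.e. root of its
characteristic polynomial) is an algebraic unit: there is no root `λ` such that both `λ`
and `λ⁻¹` are algebraic integers (with `λ ≠ 0`). -/
theorem stmt_13 (n : ℕ) (hn : 1 ≤ n) (A : Matrix (Fin n) (Fin n) ℤ) (hdet : A.det ≠ 0)
    (hstab : (⋂ k : ℕ, Set.range fun v : Fin n → ℤ => (A ^ (k + 1)).mulVec v) = {0}) :
    ∀ lam : ℂ, (Matrix.charpoly (A.map (Int.cast : ℤ → ℂ))).IsRoot lam →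
      ¬(lam ≠ 0 ∧ IsIntegral ℤ lam ∧ IsIntegral ℤ lam⁻¹) := by
  rintro lam hroot ⟨hne, -, r, hr, hr0⟩
  have hp : Polynomial.aeval lam r.reverse = 0 := by
    let := invertibleOfNonzero (inv_ne_zero hne)
    have h := (Polynomial.eval₂_reverse_eq_zero_iff (algebraMap ℤ ℂ) lam⁻¹ r).mpr hr0
    rwa [invOf_eq_inv, inv_inv] at h
  obtain ⟨v, hv, hAv⟩ := Matrix.exists_mulVec_eq_zero_iff.mpr
    (A.det_aeval_eq_zero_of_isRoot_charpoly hroot hp)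
  have hmem : v ∈ ⋂ k : ℕ, Set.range fun v : Fin n → ℤ => (A ^ (k + 1)).mulVec v :=
    Set.mem_iInter.mpr fun k => A.exists_pow_mulVec_eq_of_aeval_mulVec_eq_zero
      (by rw [Polynomial.coeff_zero_reverse, hr.leadingCoeff]) hAv (k + 1)
  rw [hstab] at hmem
  exact hv hmem
end
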